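/- Consider the static Abelian Chern–Simons–Higgs equations on ℝ² with Chern–Simons coupling κ = 0: D₁D₁φ + D₂D₂φ = (λ/2)(|φ|² − 1)φ − A₀²φ, ∂_kF_{j k} = (i/2)(φ̄ D_jφ − φ conj(D_jφ)) for j = 1,2, and ΔA₀ = |φ|² A₀. If (φ, A₁, A₂, A₀) is a smooth solution with finite energy, in particular with ∫_{ℝ²} |∇A₀|² dx < ∞, then A₀ is constant, and A₀ ≡ 0 whenever φ is not identically zero; in either case the electric field −∂_iA₀ vanishes identically, so the solution is electrically neutral. -/

import Mathlib

/-!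
Application to the Abelian Chern–Simons–Higgs theory: when the Chern–Simons
coupling κ vanishes, a smooth finite-energy solution of the static equations
on ℝ² has constant A₀ (A₀ ≡ 0 when φ ≢ 0), so the electric field −∂ᵢA₀
vanishes identically and the solution is electrically neutral.
-/

open MeasureTheory

noncomputable section

/-- The plane ℝ². -/
abbrev Plane : Type := EuclideanSpace ℝ (Fin 2)

/-- Partial derivative (real-valued) in the `i`-th coordinate direction. -/
def pd (i : Fin 2) (f : Plane → ℝ) (x : Plane) : ℝ :=
  fderiv ℝ f x (EuclideanSpace.single i 1)

/-- Partial derivative (complex-valued) in the `i`-th coordinate direction. -/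
def pdC (i : Fin 2) (f : Plane → ℂ) (x : Plane) : ℂ :=
  fderiv ℝ f x (EuclideanSpace.single i 1)

/-- The Laplacian on ℝ²: Δf = ∂₁²f + ∂₂²f. -/
def lap (f : Plane → ℝ) (x : Plane) : ℝ :=
  pd 0 (pd 0 f) x + pd 1 (pd 1 f) x

/-- Gauge-covariant derivative D_jφ = ∂_jφ + i A_j φ. -/
def covD (j : Fin 2) (A : Fin 2 → Plane → ℝ) (f : Plane → ℂ) (x : Plane) : ℂ :=
  pdC j f x + Complex.I * (A j x) * f x

lemma pd_mul (i : Fin 2) {f g : Plane → ℝ} {x : Plane}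
    (hf : DifferentiableAt ℝ f x) (hg : DifferentiableAt ℝ g x) :
    pd i (fun y => f y * g y) x = f x * pd i g x + pd i f x * g x := by
  unfold pd
  rw [fderiv_fun_mul hf hg]
  simp [mul_comm]

lemma pd_arctan (i : Fin 2) {f : Plane → ℝ} {x : Plane} (hf : DifferentiableAt ℝ f x) :
    pd i (fun y => Real.arctan (f y)) x = 1 / (1 + f x ^ 2) * pd i f x := by
  unfold pd
  rw [fderiv_arctan hf]
  simp

lemma ContDiff.pd {f : Plane → ℝ} (hf : ContDiff ℝ (⊤ : ℕ∞) f) (i : Fin 2) :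
    ContDiff ℝ (⊤ : ℕ∞) (pd i f) :=
  (hf.fderiv_right (by simp)).clm_apply contDiff_const

lemma HasCompactSupport.pd {f : Plane → ℝ} (hf : HasCompactSupport f) (i : Fin 2) :
    HasCompactSupport (pd i f) :=
  hf.fderiv_apply ℝ _

lemma norm_gradient_sq (f : Plane → ℝ) (x : Plane) :
    ‖gradient f x‖ ^ 2 = pd 0 f x ^ 2 + pd 1 f x ^ 2 := by
  have h (i : Fin 2) : pd i f x = gradient f x i := by
    unfold pd
    rw [← inner_gradient_left, EuclideanSpace.inner_single_right]
    simp
  rw [EuclideanSpace.norm_sq_eq, h, h]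
  simp

/-- Integration by parts against a compactly supported test function. -/
lemma integral_mul_pd_pd {ψ f : Plane → ℝ} (hψ : ContDiff ℝ (⊤ : ℕ∞) ψ)
    (hψc : HasCompactSupport ψ) (hf : ContDiff ℝ (⊤ : ℕ∞) f) (i : Fin 2) :
    ∫ x, (ψ x * pd i (pd i f) x + pd i ψ x * pd i f x) = 0 := by
  have hpf := hf.pd i
  have h1 : Integrable (fun x => pd i ψ x * pd i f x) :=
    ((hψ.pd i).continuous.mul hpf.continuous).integrable_of_hasCompactSupport
      ((hψc.pd i).mul_right)
  have h2 : Integrable (fun x => ψ x * pd i (pd i f) x) :=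
    (hψ.continuous.mul (hpf.pd i).continuous).integrable_of_hasCompactSupport hψc.mul_right
  have h3 : Integrable (fun x => ψ x * pd i f x) :=
    (hψ.continuous.mul hpf.continuous).integrable_of_hasCompactSupport hψc.mul_right
  have key := integral_mul_fderiv_eq_neg_fderiv_mul_of_integrable
    (v := EuclideanSpace.single i (1 : ℝ)) h1 h2 h3
    (fun x _ => (hψ.differentiable (by simp)) x) (fun x _ => (hpf.differentiable (by simp)) x)
  rw [integral_add h2 h1]
  change (∫ x, ψ x * pd i (pd i f) x) = -∫ x, pd i ψ x * pd i f x at key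
  rw [key]
  ring

/-- The divergence of `arctan f • ∇f`. -/
def arctanEnergy (f : Plane → ℝ) (x : Plane) : ℝ :=
  1 / (1 + f x ^ 2) * (pd 0 f x ^ 2 + pd 1 f x ^ 2) + Real.arctan (f x) * lap f x

lemma continuous_arctanEnergy {f : Plane → ℝ} (hf : ContDiff ℝ (⊤ : ℕ∞) f) :
    Continuous (arctanEnergy f) := by
  have h0 := hf.continuous
  have h1 (i : Fin 2) := (hf.pd i).continuous
  have h2 (i : Fin 2) := ((hf.pd i).pd i).continuous
  have hl : Continuous (lap f) := (h2 0).add (h2 1)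
  refine ((continuous_const.div (by fun_prop) fun x => ?_).mul
    (((h1 0).pow 2).add ((h1 1).pow 2))).add ((Real.continuous_arctan.comp h0).mul hl)
  positivity

lemma integrable_arctan_mul_pd_mul_pd {η f : Plane → ℝ} (hη : ContDiff ℝ (⊤ : ℕ∞) η)
    (hηc : HasCompactSupport η) (hf : ContDiff ℝ (⊤ : ℕ∞) f) :
    Integrable
      (fun x => -(Real.arctan (f x) * (pd 0 η x * pd 0 f x + pd 1 η x * pd 1 f x))) := by
  refine Continuous.integrable_of_hasCompactSupport ?_ ?_
  · exact (hf.arctan.continuous.mul (((hη.pd 0).continuous.mul (hf.pd 0).continuous).add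
      ((hη.pd 1).continuous.mul (hf.pd 1).continuous))).neg
  · have hc : HasCompactSupport (fun x => pd 0 η x * pd 0 f x + pd 1 η x * pd 1 f x) :=
      HasCompactSupport.add (hηc.pd 0).mul_right (hηc.pd 1).mul_right
    exact HasCompactSupport.neg hc.mul_left

/-- The Caccioppoli identity for the vector field `arctan f • ∇f`. -/
lemma integral_mul_arctanEnergy {η f : Plane → ℝ} (hη : ContDiff ℝ (⊤ : ℕ∞) η)
    (hηc : HasCompactSupport η) (hf : ContDiff ℝ (⊤ : ℕ∞) f) :
    ∫ x, η x * arctanEnergy f x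
      = ∫ x, -(Real.arctan (f x) * (pd 0 η x * pd 0 f x + pd 1 η x * pd 1 f x)) := by
  have ha : ContDiff ℝ (⊤ : ℕ∞) (fun x => Real.arctan (f x)) := hf.arctan
  set ψ : Plane → ℝ := fun x => η x * Real.arctan (f x) with hψ_def
  have hψ : ContDiff ℝ (⊤ : ℕ∞) ψ := hη.mul ha
  have hψc : HasCompactSupport ψ := hηc.mul_right
  have hpd (i : Fin 2) (x : Plane) : pd i ψ x
      = η x * (1 / (1 + f x ^ 2) * pd i f x) + pd i η x * Real.arctan (f x) := by
    rw [hψ_def, pd_mul i (hη.differentiable (by simp) x) (ha.differentiable (by simp) x),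
      pd_arctan i (hf.differentiable (by simp) x)]
  have hdir (i : Fin 2) :
      Integrable (fun x => ψ x * pd i (pd i f) x + pd i ψ x * pd i f x) :=
    ((hψ.continuous.mul ((hf.pd i).pd i).continuous).add
      ((hψ.pd i).continuous.mul (hf.pd i).continuous)).integrable_of_hasCompactSupport
      (hψc.mul_right.add (hψc.pd i).mul_right)
  have hsum := integral_add (hdir 0) (hdir 1)
  rw [integral_mul_pd_pd hψ hψc hf 0, integral_mul_pd_pd hψ hψc hf 1] at hsum
  have hI1 : Integrable (fun x => η x * arctanEnergy f x) :=
    (hη.continuous.mul (continuous_arctanEnergy hf)).integrable_of_hasCompactSupport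
      hηc.mul_right
  rw [← sub_eq_zero, ← integral_sub hI1 (integrable_arctan_mul_pd_mul_pd hη hηc hf)]
  calc _ = ∫ x, ((ψ x * pd 0 (pd 0 f) x + pd 0 ψ x * pd 0 f x)
            + (ψ x * pd 1 (pd 1 f) x + pd 1 ψ x * pd 1 f x)) := by
        refine integral_congr_ae (.of_forall fun x => ?_)
        simp only [hpd, arctanEnergy, lap]
        simp only [hψ_def]
        ring
    _ = 0 := by simpa using hsum

/-- Smooth cutoffs at every scale, with gradient bounded by a multiple of the inverse scale. -/
lemma exists_cutoff : ∃ C : ℝ, 0 ≤ C ∧ ∀ R : ℝ, 0 < R → ∃ η : Plane → ℝ,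
    ContDiff ℝ (⊤ : ℕ∞) η ∧ HasCompactSupport η ∧ (∀ x, 0 ≤ η x) ∧ (∀ x, η x ≤ 1) ∧
    (∀ x, ‖x‖ ≤ R → η x = 1) ∧ (∀ x, 2 * R ≤ ‖x‖ → η x = 0) ∧
    (∀ i x, |pd i η x| ≤ C / R) ∧ (∀ i x, ‖x‖ < R → pd i η x = 0) ∧
    (∀ i x, 2 * R < ‖x‖ → pd i η x = 0) := by
  let b : ContDiffBump (0 : Plane) := ⟨1, 2, by norm_num, by norm_num⟩
  have hb : ContDiff ℝ (⊤ : ℕ∞) b := b.contDiff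
  obtain ⟨C, hC⟩ := (b.hasCompactSupport.fderiv (𝕜 := ℝ)).exists_bound_of_continuous
    (hb.continuous_fderiv (by simp))
  refine ⟨C, (norm_nonneg _).trans (hC 0), fun R hR => ?_⟩
  have hnorm (x : Plane) : ‖R⁻¹ • x‖ = ‖x‖ / R := by
    rw [norm_smul, norm_inv, Real.norm_of_nonneg hR.le, inv_mul_eq_div]
  have hone (x : Plane) (hx : ‖x‖ ≤ R) : b (R⁻¹ • x) = 1 := by
    refine b.one_of_mem_closedBall ?_
    rw [mem_closedBall_zero_iff, hnorm]
    exact (div_le_one hR).2 hx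
  have hzero (x : Plane) (hx : 2 * R ≤ ‖x‖) : b (R⁻¹ • x) = 0 := by
    refine b.zero_of_le_dist ?_
    rw [dist_zero_right, hnorm]
    exact (le_div_iff₀ hR).2 hx
  have hlocal (i : Fin 2) (x : Plane) (c : ℝ) (s : Set Plane) (hs : IsOpen s) (hx : x ∈ s)
      (h : ∀ y ∈ s, b (R⁻¹ • y) = c) : pd i (fun y => b (R⁻¹ • y)) x = 0 := by
    have he : (fun y => b (R⁻¹ • y)) =ᶠ[nhds x] fun _ => c :=
      Filter.eventuallyEq_of_mem (hs.mem_nhds hx) h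
    simp [pd, he.fderiv_eq]
  refine ⟨fun x => b (R⁻¹ • x), hb.comp (contDiff_const_smul _), ?_, fun x => b.nonneg,
    fun x => b.le_one, hone, hzero, fun i x => ?_, fun i x hx => ?_, fun i x hx => ?_⟩
  · exact b.hasCompactSupport.comp_smul (inv_ne_zero hR.ne')
  · unfold pd
    rw [fderiv_comp_smul]
    have h1 : |fderiv ℝ b (R⁻¹ • x) (EuclideanSpace.single i 1)| ≤ C := by
      refine ((fderiv ℝ b (R⁻¹ • x)).le_opNorm _).trans ?_
      simpa using hC (R⁻¹ • x)
    simp only [smul_apply, smul_eq_mul, abs_mul, abs_inv, abs_of_pos hR]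
    rw [inv_mul_eq_div]
    gcongr
  · exact hlocal i x 1 {y | ‖y‖ < R} (isOpen_lt continuous_norm continuous_const) hx
      fun y hy => hone y (le_of_lt hy)
  · exact hlocal i x 0 {y | 2 * R < ‖y‖} (isOpen_lt continuous_const continuous_norm) hx
      fun y hy => hzero y (le_of_lt hy)

lemma abs_arctan_mul_mul_le {t a p c ε : ℝ} (hε : 0 < ε) (ha : |a| ≤ c) :
    |Real.arctan t * (a * p)| ≤ ε⁻¹ * p ^ 2 + ε * c ^ 2 := by
  have ht : |Real.arctan t| ≤ 2 := by
    rw [abs_le]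
    have h1 := Real.arctan_lt_pi_div_two t
    have h2 := Real.neg_pi_div_two_lt_arctan t
    have h3 := Real.pi_le_four
    constructor <;> linarith
  have hε' : ε * ε⁻¹ = 1 := mul_inv_cancel₀ hε.ne'
  rw [abs_mul, abs_mul]
  calc |Real.arctan t| * (|a| * |p|) ≤ 2 * (c * |p|) := by gcongr
    _ ≤ ε⁻¹ * |p| ^ 2 + ε * c ^ 2 := by
      have h : 0 ≤ ε⁻¹ * (|p| - ε * c) ^ 2 := by positivity
      have e : ε⁻¹ * (|p| - ε * c) ^ 2
          = ε⁻¹ * |p| ^ 2 - 2 * (ε * ε⁻¹) * (c * |p|) + (ε * ε⁻¹) * (ε * c ^ 2) := by ring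
      rw [e, hε'] at h
      linarith
    _ = _ := by rw [sq_abs]

/-- If `arctan f · Δf ≥ 0` on the plane (equivalently, `f · Δf ≥ 0`) and `f` has finite
Dirichlet energy, then `∇f = 0`. -/
theorem pd_eq_zero_of_integrable_of_arctan_mul_lap_nonneg {f : Plane → ℝ}
    (hf : ContDiff ℝ (⊤ : ℕ∞) f) (hlap : ∀ x, 0 ≤ Real.arctan (f x) * lap f x)
    (hdir : Integrable (fun x => ‖gradient f x‖ ^ 2)) (i : Fin 2) (x₀ : Plane) :
    pd i f x₀ = 0 := by
  simp only [norm_gradient_sq] at hdir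
  set G : Plane → ℝ := fun x => pd 0 f x ^ 2 + pd 1 f x ^ 2 with hG
  have hG0 (x : Plane) : 0 ≤ G x := by positivity
  have hE0 (x : Plane) : 0 ≤ arctanEnergy f x :=
    add_nonneg (mul_nonneg (by positivity) (hG0 x)) (hlap x)
  obtain ⟨C, hC, hcut⟩ := exists_cutoff
  obtain ⟨R₀, hR₀⟩ : ∃ R₀ : ℝ, R₀ = ‖x₀‖ + 1 := ⟨_, rfl⟩
  have hR₀pos : 0 < R₀ := by rw [hR₀]; positivity
  obtain ⟨η₀, hη₀, hη₀c, hη₀0, hη₀1, hη₀one, hη₀zero, -⟩ := hcut R₀ hR₀pos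
  have hcont : Continuous (fun x => η₀ x * arctanEnergy f x) :=
    hη₀.continuous.mul (continuous_arctanEnergy hf)
  set M : ℝ := 2 * C ^ 2 * (4 * volume.real (Metric.closedBall (0 : Plane) 1)) with hM
  have hbound (ε : ℝ) (hε : 0 < ε) (R : ℝ) (hR : 2 * R₀ ≤ R) :
      ∫ x, η₀ x * arctanEnergy f x ≤ ε⁻¹ * (∫ x in {x | R ≤ ‖x‖}, G x) + ε * M := by
    have hRpos : 0 < R := by linarith
    obtain ⟨η, hη, hηc, hη0, hη1, hηone, hηzero, hηb, hηin, hηout⟩ := hcut R hRpos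
    have hle (x : Plane) : η₀ x ≤ η x := by
      rcases le_total ‖x‖ R with h | h
      · rw [hηone x h]; exact hη₀1 x
      · rw [hη₀zero x (hR.trans h)]; exact hη0 x
    have hmeas : MeasurableSet {x : Plane | R ≤ ‖x‖} :=
      (isClosed_le continuous_const continuous_norm).measurableSet
    have hI1 : Integrable ({x : Plane | R ≤ ‖x‖}.indicator G) := hdir.indicator hmeas
    have hI2 : Integrable ((Metric.closedBall (0 : Plane) (2 * R)).indicator
        fun _ => 2 * (C / R) ^ 2) :=
      (integrable_indicator_iff Metric.isClosed_closedBall.measurableSet).2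
        (integrableOn_const (isCompact_closedBall _ _).measure_lt_top.ne)
    calc ∫ x, η₀ x * arctanEnergy f x ≤ ∫ x, η x * arctanEnergy f x := by
          refine integral_mono (hcont.integrable_of_hasCompactSupport hη₀c.mul_right)
            ((hη.continuous.mul (continuous_arctanEnergy hf)).integrable_of_hasCompactSupport
              hηc.mul_right) fun x => mul_le_mul_of_nonneg_right (hle x) (hE0 x)
      _ = ∫ x, -(Real.arctan (f x) * (pd 0 η x * pd 0 f x + pd 1 η x * pd 1 f x)) :=
          integral_mul_arctanEnergy hη hηc hf
      _ ≤ ∫ x, (ε⁻¹ * {x : Plane | R ≤ ‖x‖}.indicator G x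
            + ε * (Metric.closedBall (0 : Plane) (2 * R)).indicator
              (fun _ => 2 * (C / R) ^ 2) x) := by
          refine integral_mono (integrable_arctan_mul_pd_mul_pd hη hηc hf)
            ((hI1.const_mul _).add (hI2.const_mul _)) fun x => ?_
          by_cases h1 : R ≤ ‖x‖
          · by_cases h2 : ‖x‖ ≤ 2 * R
            · have k0 := abs_arctan_mul_mul_le (t := f x) (p := pd 0 f x) hε (hηb 0 x)
              have k1 := abs_arctan_mul_mul_le (t := f x) (p := pd 1 f x) hε (hηb 1 x)
              have e0 := neg_abs_le (Real.arctan (f x) * (pd 0 η x * pd 0 f x))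
              have e1 := neg_abs_le (Real.arctan (f x) * (pd 1 η x * pd 1 f x))
              simp only [Set.indicator, Set.mem_ofPred_eq, h1, mem_closedBall_zero_iff, h2,
                if_true, hG]
              linarith
            · simp only [Set.indicator, Set.mem_ofPred_eq, h1, mem_closedBall_zero_iff, h2,
                if_true, if_false, hηout _ x (not_le.1 h2)]
              have := mul_nonneg (inv_nonneg.2 hε.le) (hG0 x)
              linarith
          · have h2 : ‖x‖ ≤ 2 * R := by linarith
            simp only [Set.indicator, Set.mem_ofPred_eq, h1, mem_closedBall_zero_iff, h2,
              if_true, if_false, hηin _ x (not_le.1 h1)]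
            have : 0 ≤ ε * (2 * (C / R) ^ 2) := by positivity
            linarith
      _ = ε⁻¹ * (∫ x in {x | R ≤ ‖x‖}, G x) + ε * M := by
          rw [integral_add (hI1.const_mul _) (hI2.const_mul _), integral_const_mul,
            integral_const_mul, integral_indicator hmeas,
            integral_indicator Metric.isClosed_closedBall.measurableSet, setIntegral_const,
            Measure.addHaar_real_closedBall' volume (0 : Plane) (by positivity : 0 ≤ 2 * R)]
          simp only [finrank_euclideanSpace, Fintype.card_fin, smul_eq_mul, hM]
          field_simp
          ring
  have htail : Filter.Tendsto (fun n : ℕ => ∫ x in {x : Plane | (n : ℝ) ≤ ‖x‖}, G x)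
      Filter.atTop (nhds 0) := by
    have h := tendsto_setIntegral_of_antitone (μ := volume) (f := G)
      (s := fun n : ℕ => {x : Plane | (n : ℝ) ≤ ‖x‖})
      (fun n => (isClosed_le continuous_const continuous_norm).measurableSet)
      (fun m n hmn x (hx : (n : ℝ) ≤ ‖x‖) => (Nat.cast_le.2 hmn).trans hx)
      ⟨0, hdir.integrableOn⟩
    have he : ⋂ n : ℕ, {x : Plane | (n : ℝ) ≤ ‖x‖} = ∅ := by
      refine Set.eq_empty_of_forall_notMem fun x hx => ?_
      obtain ⟨n, hn⟩ := exists_nat_gt ‖x‖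
      exact absurd (Set.mem_iInter.1 hx n) (not_le.2 hn)
    simpa [he] using h
  have hsmall (ε : ℝ) (hε : 0 < ε) : ∫ x, η₀ x * arctanEnergy f x ≤ ε * M := by
    have hlim : Filter.Tendsto
        (fun n : ℕ => ε⁻¹ * (∫ x in {x : Plane | (n : ℝ) ≤ ‖x‖}, G x) + ε * M)
        Filter.atTop (nhds (ε * M)) := by
      simpa using (htail.const_mul ε⁻¹).add_const (ε * M)
    refine ge_of_tendsto hlim ?_
    filter_upwards [(tendsto_natCast_atTop_atTop (R := ℝ)).eventually_ge_atTop (2 * R₀)] with n hn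
    exact hbound ε hε n hn
  have hnonpos : ∫ x, η₀ x * arctanEnergy f x ≤ 0 := by
    have hlim : Filter.Tendsto (fun ε : ℝ => ε * M) (nhdsWithin 0 (Set.Ioi 0)) (nhds 0) := by
      have h : Filter.Tendsto (fun ε : ℝ => ε * M) (nhds 0) (nhds (0 * M)) :=
        (continuous_id.mul continuous_const).tendsto 0
      rw [zero_mul] at h
      exact h.mono_left nhdsWithin_le_nhds
    refine ge_of_tendsto hlim ?_
    filter_upwards [self_mem_nhdsWithin] with ε hε
    exact hsmall ε hε
  have hzero : η₀ x₀ * arctanEnergy f x₀ = 0 := by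
    by_contra hne
    exact absurd (hcont.integral_pos_of_hasCompactSupport_nonneg_nonzero (μ := volume)
      hη₀c.mul_right (fun x => mul_nonneg (hη₀0 x) (hE0 x)) hne) (not_lt.2 hnonpos)
  rw [hη₀one x₀ (by linarith), one_mul] at hzero
  have hp : (0 : ℝ) < 1 / (1 + f x₀ ^ 2) := by positivity
  have hGz : G x₀ = 0 := by
    have h1 : 1 / (1 + f x₀ ^ 2) * G x₀ = 0 :=
      le_antisymm (by
        have := hlap x₀
        simp only [arctanEnergy] at hzero
        simp only [hG]
        linarith) (mul_nonneg hp.le (hG0 x₀))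
    exact (mul_eq_zero.1 h1).resolve_left hp.ne'
  have h0 := sq_nonneg (pd 0 f x₀)
  have h1 := sq_nonneg (pd 1 f x₀)
  simp only [hG] at hGz
  fin_cases i
  · exact pow_eq_zero_iff (two_ne_zero) |>.1 (by linarith : pd 0 f x₀ ^ 2 = 0)
  · exact pow_eq_zero_iff (two_ne_zero) |>.1 (by linarith : pd 1 f x₀ ^ 2 = 0)

lemma eq_of_pd_eq_zero {f : Plane → ℝ} (hf : Differentiable ℝ f)
    (h : ∀ i x, pd i f x = 0) (x y : Plane) : f x = f y := by
  refine is_const_of_fderiv_eq_zero hf (fun z => ?_) x y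
  refine ContinuousLinearMap.coe_injective
    ((EuclideanSpace.basisFun (Fin 2) ℝ).toBasis.ext fun i => ?_)
  simpa [pd] using h i z

lemma arctan_mul_self_nonneg (t : ℝ) : 0 ≤ Real.arctan t * t := by
  rcases le_total 0 t with h | h
  · exact mul_nonneg (Real.arctan_nonneg.2 h) h
  · exact mul_nonneg_of_nonpos_of_nonpos (by simpa using Real.arctan_mono h) h

theorem chern_simons_higgs_kappa_zero_neutral
    (lam : ℝ) (hlam : 0 < lam)
    (φ : Plane → ℂ) (A₀ A₁ A₂ : Plane → ℝ)
    (hφ : ContDiff ℝ (⊤ : ℕ∞) φ) (hA₀ : ContDiff ℝ (⊤ : ℕ∞) A₀)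
    (hA₁ : ContDiff ℝ (⊤ : ℕ∞) A₁) (hA₂ : ContDiff ℝ (⊤ : ℕ∞) A₂)
    -- the Higgs equation D₁D₁φ + D₂D₂φ = (λ/2)(|φ|² − 1)φ − A₀²φ
    (hHiggs : ∀ x, covD 0 ![A₁, A₂] (covD 0 ![A₁, A₂] φ) x
        + covD 1 ![A₁, A₂] (covD 1 ![A₁, A₂] φ) x
        = (lam / 2 * (‖φ x‖ ^ 2 - 1) : ℝ) * φ x - ((A₀ x) ^ 2 : ℝ) * φ x)
    -- the κ = 0 Maxwell equation, j = 1: ∂₂F₁₂ = (i/2)(φ̄ D₁φ − φ conj(D₁φ))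
    (hMax1 : ∀ x, ((pd 1 (fun y => pd 0 A₂ y - pd 1 A₁ y) x : ℝ) : ℂ)
        = Complex.I / 2 * ((starRingEnd ℂ) (φ x) * covD 0 ![A₁, A₂] φ x
            - φ x * (starRingEnd ℂ) (covD 0 ![A₁, A₂] φ x)))
    -- the κ = 0 Maxwell equation, j = 2: ∂₁F₂₁ = (i/2)(φ̄ D₂φ − φ conj(D₂φ))
    (hMax2 : ∀ x, ((-(pd 0 (fun y => pd 0 A₂ y - pd 1 A₁ y) x) : ℝ) : ℂ)
        = Complex.I / 2 * ((starRingEnd ℂ) (φ x) * covD 1 ![A₁, A₂] φ x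
            - φ x * (starRingEnd ℂ) (covD 1 ![A₁, A₂] φ x)))
    -- the κ = 0 Gauss law ΔA₀ = |φ|² A₀
    (hGauss : ∀ x, lap A₀ x = ‖φ x‖ ^ 2 * A₀ x)
    -- finite energy
    (hfin : Integrable (fun x =>
        (1 / 2) * ‖gradient A₀ x‖ ^ 2 + (1 / 2) * (A₀ x) ^ 2 * ‖φ x‖ ^ 2
        + (1 / 2) * (pd 0 A₂ x - pd 1 A₁ x) ^ 2
        + (1 / 2) * (‖covD 0 ![A₁, A₂] φ x‖ ^ 2 + ‖covD 1 ![A₁, A₂] φ x‖ ^ 2)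
        + lam / 8 * (‖φ x‖ ^ 2 - 1) ^ 2))
    -- in particular, finite Dirichlet energy of A₀
    (hfin' : Integrable (fun x => ‖gradient A₀ x‖ ^ 2)) :
    (∃ c : ℝ, ∀ x, A₀ x = c) ∧
    ((∃ x, φ x ≠ 0) → ∀ x, A₀ x = 0) ∧
    (∀ i x, -(pd i A₀ x) = 0) := by
  have hpd : ∀ i x, pd i A₀ x = 0 := by
    refine pd_eq_zero_of_integrable_of_arctan_mul_lap_nonneg hA₀ (fun x => ?_) hfin'
    rw [hGauss, mul_left_comm]
    exact mul_nonneg (by positivity) (arctan_mul_self_nonneg _)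
  have hconst := eq_of_pd_eq_zero (hA₀.differentiable (by simp)) hpd
  refine ⟨⟨A₀ 0, fun x => hconst x 0⟩, ?_, fun i x => by rw [hpd, neg_zero]⟩
  rintro ⟨y, hy⟩ x
  have hfun (i : Fin 2) : pd i A₀ = fun _ => 0 := funext (hpd i)
  have hl : lap A₀ y = 0 := by simp [lap, hfun, pd]
  rw [hGauss] at hl
  rw [hconst x y]
  exact (mul_eq_zero.1 hl).resolve_left (by positivity)

end
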